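/- There exists an absolute constant K > 0 such that the following holds. Let a, b be positive integers such that √(b/a) is irrational, let η ∈ (0, 1] and M ≥ 1. Then the number of integers m with M ≤ m < 2M satisfying ‖ m √(b/a) ‖ ≤ η is at most K · ( η M + √(η M) · (ab)^{1/4} + 1 ). -/

import Mathlib

/-- For a real number `t`, the distance from `t` to the nearest integer. -/
noncomputable def distNearestInt (t : ℝ) : ℝ := |t - (round t : ℤ)|

/-- A finite family of reals of diameter at most `L` whose distinct members are `d`-separated has
at most `L / d + 1` members. -/
theorem card_le_of_separated {ι : Type*} (s : Finset ι) (g : ι → ℝ) {L d : ℝ} (hd : 0 < d)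
    (hL : 0 ≤ L) (hdiam : ∀ i ∈ s, ∀ j ∈ s, |g i - g j| ≤ L)
    (hsep : ∀ i ∈ s, ∀ j ∈ s, i ≠ j → d ≤ |g i - g j|) :
    (s.card : ℝ) ≤ L / d + 1 := by
  rcases s.eq_empty_or_nonempty with rfl | hne
  · simp only [Finset.card_empty, Nat.cast_zero]
    positivity
  obtain ⟨i₀, hi₀, hmin⟩ := s.exists_min_image g hne
  have hcard : s.card ≤ (Finset.range (⌊L / d⌋₊ + 1)).card := by
    refine Finset.card_le_card_of_injOn (fun i => ⌊(g i - g i₀) / d⌋₊) ?_ ?_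
    · intro i hi
      simp only [Finset.coe_range, Set.mem_Iio, Nat.lt_succ_iff]
      apply Nat.floor_le_floor
      gcongr
      exact (le_abs_self _).trans (hdiam i hi i₀ hi₀)
    · intro i hi j hj hij
      by_contra hne'
      have h := hsep i hi j hj hne'
      have hi0 : 0 ≤ (g i - g i₀) / d := div_nonneg (sub_nonneg.2 (hmin i hi)) hd.le
      have hj0 : 0 ≤ (g j - g i₀) / d := div_nonneg (sub_nonneg.2 (hmin j hj)) hd.le
      have hij' : ⌊(g i - g i₀) / d⌋₊ = ⌊(g j - g i₀) / d⌋₊ := hij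
      have h1 := Nat.floor_le hi0
      have h2 := Nat.lt_floor_add_one ((g i - g i₀) / d)
      have h3 := Nat.floor_le hj0
      have h4 := Nat.lt_floor_add_one ((g j - g i₀) / d)
      rw [hij'] at h1 h2
      have h5 : |(g i - g i₀) / d - (g j - g i₀) / d| < 1 := by
        rw [abs_lt]
        constructor <;> linarith
      rw [← sub_div, sub_sub_sub_cancel_right, abs_div, abs_of_pos hd, div_lt_one hd] at h5
      linarith
  rw [Finset.card_range] at hcard
  calc (s.card : ℝ) ≤ ((⌊L / d⌋₊ + 1 : ℕ) : ℝ) := by exact_mod_cast hcard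
    _ ≤ L / d + 1 := by
      push_cast
      gcongr
      exact Nat.floor_le (by positivity)

/-- Irrational square roots of rationals are badly approximable, with an explicit constant. -/
theorem one_le_mul_abs_mul_sub {α : ℝ} (hα : 0 < α) (hirr : Irrational α) {a b : ℕ} (ha : 0 < a)
    (hb : 0 < b) (hab : α ^ 2 * a = b) {q : ℤ} (p : ℤ) (hq : 0 < q) :
    1 ≤ 3 * (α * a) * (q * |q * α - p|) := by
  have haR : (1 : ℝ) ≤ a := by exact_mod_cast ha
  have hbR : (1 : ℝ) ≤ b := by exact_mod_cast hb
  have hqR : (1 : ℝ) ≤ q := by exact_mod_cast hq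
  have hαa : 1 ≤ α * a := by
    have : (1 : ℝ) ≤ (α * a) ^ 2 := by
      have : (α * a) ^ 2 = b * a := by rw [← hab]; ring
      rw [this]
      nlinarith
    nlinarith [mul_pos hα (by linarith : (0 : ℝ) < a)]
  rcases le_or_gt |(p : ℝ)| (2 * (q * α)) with hp | hp
  · have hirr' : ∀ p' : ℤ, (q : ℝ) * α - p' ≠ 0 := by
      intro p' h
      refine hirr ⟨(p' : ℚ) / q, ?_⟩
      push_cast
      rw [div_eq_iff (by positivity)]
      linarith
    have hfac : ((b * q ^ 2 - a * p ^ 2 : ℤ) : ℝ) = a * ((q * α - p) * (q * α + p)) := by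
      push_cast
      rw [← hab]
      ring
    have hne : (b * q ^ 2 - a * p ^ 2 : ℤ) ≠ 0 := by
      have h2 := hirr' (-p)
      push_cast at h2
      rw [sub_neg_eq_add] at h2
      rw [← Int.cast_ne_zero (α := ℝ), hfac]
      exact mul_ne_zero (by positivity) (mul_ne_zero (hirr' p) h2)
    have hone : (1 : ℝ) ≤ |((b * q ^ 2 - a * p ^ 2 : ℤ) : ℝ)| := by
      exact_mod_cast Int.one_le_abs hne
    rw [hfac, abs_mul, abs_mul, abs_of_pos (by positivity : (0 : ℝ) < a)] at hone
    have hsum : |(q : ℝ) * α + p| ≤ 3 * (q * α) := by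
      have := abs_add_le ((q : ℝ) * α) p
      rw [abs_of_pos (by positivity : 0 < (q : ℝ) * α)] at this
      linarith
    calc (1 : ℝ) ≤ a * (|q * α - p| * |q * α + p|) := hone
      _ ≤ a * (|q * α - p| * (3 * (q * α))) := by gcongr
      _ = _ := by ring
  · have hqα : 0 < (q : ℝ) * α := by positivity
    have hp0 : p ≠ 0 := by
      rintro rfl
      simp only [Int.cast_zero, abs_zero] at hp
      linarith
    have hp1 : (1 : ℝ) ≤ |(p : ℝ)| := by exact_mod_cast Int.one_le_abs hp0
    have hδ : 1 / 2 ≤ |(q : ℝ) * α - p| := by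
      have := abs_sub_abs_le_abs_sub (p : ℝ) (q * α)
      rw [abs_sub_comm, abs_of_pos hqα] at this
      linarith
    calc (1 : ℝ) ≤ 3 * 1 * (1 * (1 / 2)) := by norm_num
      _ ≤ _ := by gcongr

/-- Lattice points `(m, f m)` in the strip `|m α - f m| ≤ η` over an interval of length `M`, counted
by slicing along a shortest difference vector, of relative length `l`. -/
theorem exists_pair_card_le (S : Finset ℕ) (f : ℕ → ℤ) (α : ℝ) {η M : ℝ} (hη : 0 < η) (hM : 0 < M)
    (hx : ∀ m ∈ S, ∀ n ∈ S, |(m : ℝ) - n| ≤ M) (hy : ∀ m ∈ S, |m * α - f m| ≤ η)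
    (hS : 1 < S.card) :
    ∃ q p : ℤ, ∃ l : ℝ, 0 < q ∧ 0 < l ∧ q ≤ l * M ∧ |q * α - p| ≤ l * (2 * η) ∧
      (S.card : ℝ) ≤ 1 + 1 / l + 8 * (η * M) := by
  set y : ℕ → ℝ := fun m => m * α - f m with hydef
  set D : ℕ × ℕ → ℝ := fun z => max (|(z.1 : ℝ) - z.2| / M) (|y z.1 - y z.2| / (2 * η)) with hD
  have hyd : ∀ m ∈ S, ∀ n ∈ S, |y m - y n| ≤ 2 * η := by
    intro m hm n hn
    have := abs_sub (y m) (y n)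
    have h1 : |y m| ≤ η := hy m hm
    have h2 : |y n| ≤ η := hy n hn
    linarith
  let P := (S ×ˢ S).filter (fun z => z.2 < z.1)
  have hP : P.Nonempty := by
    obtain ⟨m, hm, n, hn, hmn⟩ := Finset.one_lt_card.1 hS
    rcases lt_or_gt_of_ne hmn with h | h
    · exact ⟨(n, m), by simp [P, hm, hn, h]⟩
    · exact ⟨(m, n), by simp [P, hm, hn, h]⟩
  obtain ⟨⟨u, v⟩, huv, hmin⟩ := P.exists_min_image D hP
  simp only [P, Finset.mem_filter, Finset.mem_product] at huv
  obtain ⟨⟨hu, hv⟩, hvu⟩ := huv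
  have hminD : ∀ m ∈ S, ∀ n ∈ S, m ≠ n → D (u, v) ≤ D (m, n) := by
    intro m hm n hn hmn
    rcases lt_or_gt_of_ne hmn with h | h
    · have := hmin (n, m) (by simp [P, hm, hn, h])
      simpa [hD, abs_sub_comm] using this
    · exact hmin (m, n) (by simp [P, hm, hn, h])
  set q : ℤ := (u : ℤ) - v with hq
  set p : ℤ := f u - f v with hp
  set l : ℝ := D (u, v) with hl
  have hq0 : 0 < q := by omega
  have hqR : (0 : ℝ) < q := by exact_mod_cast hq0
  have hqe : (u : ℝ) - v = q := by rw [hq]; push_cast; ring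
  have hδe : y u - y v = q * α - p := by rw [hydef, hq, hp]; push_cast; ring
  set δ : ℝ := q * α - p with hδ
  have hlmax : l = max (q / M) (|δ| / (2 * η)) := by
    rw [hl, hD]
    simp only [hqe, hδe, abs_of_pos hqR]
  have hql : q / M ≤ l := hlmax ▸ le_max_left _ _
  have hδl : |δ| / (2 * η) ≤ l := hlmax ▸ le_max_right _ _
  have hl0 : 0 < l := lt_of_lt_of_le (by positivity) hql
  have hl1 : l ≤ 1 := by
    rw [hlmax, max_le_iff, div_le_one hM, div_le_one (by positivity), ← hδe, ← hqe]
    exact ⟨(le_abs_self _).trans (hx u hu v hv), hyd u hu v hv⟩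
  have hql' : (q : ℝ) ≤ l * M := (div_le_iff₀ hM).1 hql
  have hδl' : |δ| ≤ l * (2 * η) := (div_le_iff₀ (by positivity)).1 hδl
  refine ⟨q, p, l, hq0, hl0, hql', hδl', ?_⟩
  let φ : ℕ → ℤ := fun m => q * f m - p * m
  have hφ : ∀ m, (φ m : ℝ) = m * δ - q * y m := by
    intro m
    simp only [φ, hydef, hδ]
    push_cast
    ring
  have himage : ((S.image φ).card : ℝ) ≤ 4 * l * (η * M) + 1 := by
    have := card_le_of_separated (S.image φ) (fun k : ℤ => (k : ℝ)) (L := 4 * l * (η * M))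
      one_pos (by positivity) ?_ ?_
    · simpa using this
    · simp only [Finset.forall_mem_image]
      intro m hm n hn
      rw [hφ, hφ]
      calc |m * δ - q * y m - (n * δ - q * y n)|
          = |(m - n : ℝ) * δ - q * (y m - y n)| := by ring_nf
        _ ≤ |(m - n : ℝ) * δ| + |q * (y m - y n)| := abs_sub _ _
        _ = |(m - n : ℝ)| * |δ| + q * |y m - y n| := by
          rw [abs_mul, abs_mul, abs_of_pos hqR]
        _ ≤ M * (l * (2 * η)) + (l * M) * (2 * η) := by
          gcongr
          · exact hx m hm n hn
          · exact hyd m hm n hn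
        _ = 4 * l * (η * M) := by ring
    · intro i _ j _ hij
      exact_mod_cast Int.one_le_abs (sub_ne_zero.2 hij)
  have hfiber : ∀ k ∈ S.image φ, (S.filter (fun m => φ m = k)).card ≤ ⌊1 / l + 1⌋₊ := by
    intro k _
    apply Nat.le_floor
    have hratio : ∀ m ∈ S.filter (fun m => φ m = k), ∀ n ∈ S.filter (fun m => φ m = k), m ≠ n →
        l ≤ |(m : ℝ) - n| / q * l ∧ |y m - y n| = |(m : ℝ) - n| / q * |δ| := by
      intro m hm n hn hmn
      rw [Finset.mem_filter] at hm hn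
      have he : (φ m : ℝ) = φ n := by rw [hm.2, hn.2]
      rw [hφ, hφ] at he
      have hyy : y m - y n = (m - n : ℝ) / q * δ := by
        field_simp
        linarith
      have hyy' : |y m - y n| = |(m : ℝ) - n| / q * |δ| := by
        rw [hyy, abs_mul, abs_div, abs_of_pos hqR]
      refine ⟨?_, hyy'⟩
      have h := hminD m hm.1 n hn.1 hmn
      refine h.trans ?_
      rw [hD]
      simp only [hyy']
      apply max_le
      · calc |(m : ℝ) - n| / M = |(m : ℝ) - n| / q * (q / M) := by field_simp
          _ ≤ _ := by gcongr
      · rw [mul_div_assoc]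
        gcongr
    have hsep : ∀ m ∈ S.filter (fun m => φ m = k), ∀ n ∈ S.filter (fun m => φ m = k), m ≠ n →
        1 ≤ |(m : ℝ) - n| / q := fun m hm n hn hmn =>
      le_of_mul_le_mul_right (by simpa using (hratio m hm n hn hmn).1) hl0
    rcases max_choice (q / M) (|δ| / (2 * η)) with h | h
    · have h' : 1 / l = M / q := by rw [hlmax, h, one_div_div]
      rw [h']
      refine card_le_of_separated _ (fun m : ℕ => (m : ℝ)) hqR hM.le ?_ ?_
      · intro m hm n hn
        exact hx m (Finset.mem_filter.1 hm).1 n (Finset.mem_filter.1 hn).1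
      · intro m hm n hn hmn
        simpa using (le_div_iff₀ hqR).1 (hsep m hm n hn hmn)
    · have h' : 1 / l = 2 * η / |δ| := by rw [hlmax, h, one_div_div]
      have hδ0 : 0 < |δ| := by
        rcases (abs_nonneg δ).eq_or_lt with h0 | h0
        · rw [hlmax, h, ← h0] at hl0
          simp at hl0
        · exact h0
      rw [h']
      refine card_le_of_separated _ y hδ0 (by positivity) ?_ ?_
      · intro m hm n hn
        exact hyd m (Finset.mem_filter.1 hm).1 n (Finset.mem_filter.1 hn).1
      · intro m hm n hn hmn
        rw [(hratio m hm n hn hmn).2]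
        exact le_mul_of_one_le_left hδ0.le (hsep m hm n hn hmn)
  have hcard : (S.card : ℝ) ≤ (⌊1 / l + 1⌋₊ : ℝ) * ((S.image φ).card : ℝ) := by
    exact_mod_cast Finset.card_le_mul_card_image S _ hfiber
  calc (S.card : ℝ) ≤ (⌊1 / l + 1⌋₊ : ℝ) * ((S.image φ).card : ℝ) := hcard
    _ ≤ (1 / l + 1) * (4 * l * (η * M) + 1) := by
      gcongr
      exact Nat.floor_le (by positivity)
    _ = 1 + 1 / l + (4 * (η * M) + 4 * l * (η * M)) := by
      field_simp
      ring
    _ ≤ 1 + 1 / l + 8 * (η * M) := by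
      have : l * (η * M) ≤ 1 * (η * M) := by gcongr
      linarith

theorem lattice_point_counting :
    ∃ K : ℝ, 0 < K ∧
      ∀ a b : ℕ, 0 < a → 0 < b → Irrational (Real.sqrt ((b : ℝ) / (a : ℝ))) →
        ∀ η M : ℝ, 0 < η → η ≤ 1 → 1 ≤ M →
          (((Finset.range (⌊2 * M⌋₊ + 1)).filter (fun m : ℕ =>
              M ≤ (m : ℝ) ∧ (m : ℝ) < 2 * M ∧
                distNearestInt ((m : ℝ) * Real.sqrt ((b : ℝ) / (a : ℝ))) ≤ η)).card : ℝ)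
            ≤ K * (η * M + Real.sqrt (η * M) * ((a * b : ℕ) : ℝ) ^ ((1 : ℝ) / 4) + 1) := by
  refine ⟨8, by norm_num, ?_⟩
  intro a b ha hb hirr η M hη _ hM1
  have hM : 0 < M := by linarith
  have haR : (0 : ℝ) < a := by exact_mod_cast ha
  have hbR : (0 : ℝ) < b := by exact_mod_cast hb
  set α := Real.sqrt ((b : ℝ) / (a : ℝ)) with hα
  have hα0 : 0 < α := Real.sqrt_pos.2 (by positivity)
  have hab : α ^ 2 * a = b := by
    rw [hα, Real.sq_sqrt (by positivity)]
    field_simp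
  set r : ℝ := ((a * b : ℕ) : ℝ) ^ ((1 : ℝ) / 4) with hr
  have hr0 : 0 < r := Real.rpow_pos_of_pos (by positivity) _
  have hr2 : r ^ 2 = α * a := by
    have h4 : r ^ 4 = a * b := by
      rw [hr, ← Real.rpow_natCast, ← Real.rpow_mul (by positivity)]
      norm_num
    rw [← sq_eq_sq₀ (by positivity) (by positivity)]
    calc (r ^ 2) ^ 2 = r ^ 4 := by ring
      _ = (α * a) ^ 2 := by rw [h4, ← hab]; ring
  set S := (Finset.range (⌊2 * M⌋₊ + 1)).filter (fun m : ℕ =>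
    M ≤ (m : ℝ) ∧ (m : ℝ) < 2 * M ∧ distNearestInt ((m : ℝ) * α) ≤ η) with hS
  rcases le_or_gt S.card 1 with h1 | h1
  · have h1' : (S.card : ℝ) ≤ 1 := by exact_mod_cast h1
    have : 0 ≤ η * M + Real.sqrt (η * M) * r := by positivity
    linarith
  have hmem : ∀ m ∈ S, M ≤ (m : ℝ) ∧ (m : ℝ) < 2 * M ∧ distNearestInt ((m : ℝ) * α) ≤ η :=
    fun m hm => (Finset.mem_filter.1 hm).2
  obtain ⟨q, p, l, hq, hl, hql, hδl, hcard⟩ := exists_pair_card_le S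
    (fun m => round ((m : ℝ) * α)) α hη hM
    (fun m hm n hn => by
      have h₁ := hmem m hm
      have h₂ := hmem n hn
      rw [abs_le]
      constructor <;> linarith)
    (fun m hm => (hmem m hm).2.2) h1
  have hqR : (0 : ℝ) < q := by exact_mod_cast hq
  have hl_inv : 1 / l ≤ 8 * (Real.sqrt (η * M) * r) := by
    have hs := Real.sq_sqrt (by positivity : 0 ≤ η * M)
    have h : 1 ≤ 6 * (l * (Real.sqrt (η * M) * r)) ^ 2 := by
      calc (1 : ℝ) ≤ 3 * (α * a) * (q * |q * α - p|) :=
            one_le_mul_abs_mul_sub hα0 hirr ha hb hab p hq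
        _ ≤ 3 * (α * a) * ((l * M) * (l * (2 * η))) := by gcongr
        _ = 6 * (l * (Real.sqrt (η * M) * r)) ^ 2 := by
          rw [mul_pow, mul_pow, hs, hr2]
          ring
    have h0 : 0 ≤ l * (Real.sqrt (η * M) * r) := by positivity
    rw [div_le_iff₀ hl]
    nlinarith
  linarith
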